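/- arXiv:2305.02793 — 4 statements merged into one kernel-verified Lean document; each statement's English description precedes it below -/
import Mathlib

section
/- In an Emerson-Lei game with a finite set C of colors, |C| = k, every node in the winning region W∃ of the existential player is won by a finite-memory strategy whose memory set is the set L of leaves of the Zielonka tree Z_φ; in particular, since |L| ≤ k!, winning strategies with memory at most k! suffice. -/
/-- Emerson-Lei formulas over a set `C` of colors: Boolean formulas over atoms `Inf c`. -/
inductive ELFormula (C : Type) : Type
  | tt : ELFormula C
  | ff : ELFormula C
  | inf : C → ELFormula C
  | not : ELFormula C → ELFormula C
  | and : ELFormula C → ELFormula C → ELFormula C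
  | or : ELFormula C → ELFormula C → ELFormula C

/-- Satisfaction of an Emerson-Lei formula by a set `D` of colors. -/
def ELSat {C : Type} (D : Set C) : ELFormula C → Prop
  | .tt => True
  | .ff => False
  | .inf c => c ∈ D
  | .not f => ¬ ELSat D f
  | .and f g => ELSat D f ∧ ELSat D g
  | .or f g => ELSat D f ∨ ELSat D g

/-- `D` is a candidate child-label for a vertex labeled `L`:
`D ⊊ L` and `D ⊨ φ ⟺ L ⊭ φ`. -/
def ELCand {C : Type} [DecidableEq C] (φ : ELFormula C) (L D : Finset C) : Prop :=
  D ⊂ L ∧ (ELSat (↑D) φ ↔ ¬ ELSat (↑L) φ)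

/-- `D` is maximal among the candidate child-labels for a vertex labeled `L`. -/
def ELMaxCand {C : Type} [DecidableEq C] (φ : ELFormula C) (L D : Finset C) : Prop :=
  ELCand φ L D ∧ ∀ D' : Finset C, ELCand φ L D' → D ⊆ D' → D = D'

/-- The Zielonka tree of an Emerson-Lei formula `φ` over a finite set `C` of colors:
a finite tree rooted at `root`, whose root is labeled `C`, and in which every vertex `s`
has exactly one child labeled `D` for each `D` maximal among
`{D' ⊊ l(s) | D' ⊨ φ ⟺ l(s) ⊭ φ}`. -/
structure ZielonkaTree (C : Type) [Fintype C] [DecidableEq C] (φ : ELFormula C) where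
  V : Type
  [finV : Fintype V]
  [decV : DecidableEq V]
  root : V
  children : V → Finset V
  label : V → Finset C
  root_label : label root = Finset.univ
  reach_root : ∀ t, Relation.ReflTransGen (fun a b => b ∈ children a) root t
  parent_unique : ∀ ⦃s s' t⦄, t ∈ children s → t ∈ children s' → s = s'
  root_not_child : ∀ s, root ∉ children s
  child_maximal : ∀ ⦃s t⦄, t ∈ children s → ELMaxCand φ (label s) (label t)
  child_exists : ∀ ⦃s⦄ ⦃D : Finset C⦄, ELMaxCand φ (label s) D → ∃ t ∈ children s, label t = D
  child_label_inj : ∀ ⦃s t t'⦄, t ∈ children s → t' ∈ children s → label t = label t' → t = t'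

attribute [instance] ZielonkaTree.finV ZielonkaTree.decV

/-- A game arena: a set of nodes (the type `N`) partitioned into existential nodes
(`Vex`) and universal nodes (the complement), with a move relation `E` such that every
node has at least one successor. -/
structure Arena (N : Type) where
  Vex : Set N
  E : N → Set N
  E_nonempty : ∀ v, (E v).Nonempty

/-- A play of an arena: an infinite sequence of nodes following moves. -/
def Arena.IsPlay {N : Type} (A : Arena N) (π : ℕ → N) : Prop :=
  ∀ i, π (i + 1) ∈ A.E (π i)

/-- The existential player wins node `v` for objective `α`: there is a strategy
(mapping a history together with a current existential node to a successor) such that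
every play starting at `v` and compliant with it satisfies `α`. -/
def WinsFrom {N : Type} (A : Arena N) (α : (ℕ → N) → Prop) (v : N) : Prop :=
  ∃ σ : List N → N → N,
    (∀ h u, u ∈ A.Vex → σ h u ∈ A.E u) ∧
    ∀ π : ℕ → N, A.IsPlay π → π 0 = v →
      (∀ i, π i ∈ A.Vex → π (i + 1) = σ ((List.range i).map π) (π i)) → α π

/-- The Emerson-Lei objective `α_{γ,φ}`: the set of colors visited infinitely often
by the play satisfies `φ`. -/
def ELObjective {N C : Type} (γ : N → Finset C) (φ : ELFormula C) (π : ℕ → N) : Prop :=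
  ELSat {c : C | ∀ M : ℕ, ∃ i ≥ M, c ∈ γ (π i)} φ

namespace ZielonkaTree

variable {C : Type} [Fintype C] [DecidableEq C] {φ : ELFormula C}

/-- The ancestor ordering of the Zielonka tree: `Z.anc s t` iff `s` is an ancestor of `t`
(or `s = t`). -/
def anc (Z : ZielonkaTree C φ) (s t : Z.V) : Prop :=
  Relation.ReflTransGen (fun a b => b ∈ Z.children a) s t

/-- A leaf of the Zielonka tree. -/
def IsLeaf (Z : ZielonkaTree C φ) (t : Z.V) : Prop := Z.children t = ∅

/-- A winning vertex of the Zielonka tree (an element of `T_□`): its label satisfies `φ`. -/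
def Winning (Z : ZielonkaTree C φ) (t : Z.V) : Prop := ELSat (↑(Z.label t)) φ

/-- `s` is the anchor node of `t` at a node colored `g`: the lowermost ancestor of `t`
whose label contains `g`. -/
def IsAnchor (Z : ZielonkaTree C φ) (g : Finset C) (t s : Z.V) : Prop :=
  Z.anc s t ∧ g ⊆ Z.label s ∧ ∀ s', Z.anc s' t → g ⊆ Z.label s' → Z.anc s' s

end ZielonkaTree

/-- A strategy with memory `M` for the existential player: an initial memory value,
a memory update function, and a move function choosing successors of existential nodes. -/
structure FMStrategy {N : Type} (A : Arena N) (M : Type) where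
  m0 : M
  upd : M → N → M
  mov : N → M → N
  mov_valid : ∀ v m, v ∈ A.Vex → mov v m ∈ A.E v

/-- The memory value obtained by folding the update function over the history
`π 0 … π n`, starting from the initial memory value. -/
def FMStrategy.memAt {N M : Type} {A : Arena N} (st : FMStrategy A M)
    (π : ℕ → N) (n : ℕ) : M :=
  List.foldl st.upd st.m0 (((List.range (n + 1)).map π))

/-- A play is compliant with a finite-memory strategy if at every existential node the
play follows the strategy's move for the current memory value. -/
def FMStrategy.Compliant {N M : Type} {A : Arena N} (st : FMStrategy A M)
    (π : ℕ → N) : Prop :=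
  ∀ i, π i ∈ A.Vex → π (i + 1) = st.mov (π i) (st.memAt π i)

/-- The existential player wins node `v` with a finite-memory strategy over memory `M`. -/
def FMWinsFrom {N : Type} (A : Arena N) (α : (ℕ → N) → Prop) (M : Type) (v : N) : Prop :=
  ∃ st : FMStrategy A M, ∀ π : ℕ → N, A.IsPlay π → π 0 = v → st.Compliant π → α π

namespace ZielonkaTree

variable {C : Type} [Fintype C] [DecidableEq C] {φ : ELFormula C} (Z : ZielonkaTree C φ)

/-- The number of colors missing from the label of a vertex. -/
def prio (t : Z.V) : ℕ := (Z.label t)ᶜ.card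

variable {Z}

theorem label_ssubset_of_mem_children {s t : Z.V} (h : t ∈ Z.children s) :
    Z.label t ⊂ Z.label s :=
  (Z.child_maximal h).1.1

theorem anc.label_subset {s t : Z.V} (h : Z.anc s t) : Z.label t ⊆ Z.label s := by
  induction h with
  | refl => exact subset_rfl
  | tail _ hc ih => exact (label_ssubset_of_mem_children hc).subset.trans ih

theorem anc.trans {s t u : Z.V} (h : Z.anc s t) (h' : Z.anc t u) : Z.anc s u :=
  Relation.ReflTransGen.trans h h'

theorem anc.eq_or_child {s t : Z.V} (h : Z.anc s t) :
    s = t ∨ ∃ c ∈ Z.children s, Z.anc c t := by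
  rcases Relation.ReflTransGen.cases_head h with h | h
  · exact Or.inl h
  · exact Or.inr h

theorem IsLeaf.eq_of_anc {s t : Z.V} (hs : Z.IsLeaf s) (h : Z.anc s t) : s = t := by
  rcases h.eq_or_child with h | ⟨c, hc, -⟩
  · exact h
  · rw [hs] at hc
    simp at hc

theorem anc.total {s s' t : Z.V} (h : Z.anc s t) (h' : Z.anc s' t) :
    Z.anc s s' ∨ Z.anc s' s := by
  induction h with
  | refl => exact Or.inr h'
  | tail hb hc ih =>
    rcases Relation.ReflTransGen.cases_tail h' with h' | ⟨b', hb', hc'⟩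
    · subst h'
      exact Or.inl (hb.tail hc)
    · rw [Z.parent_unique hc' hc] at hb'
      exact ih hb'

theorem anc.eq_of_prio_le {s t : Z.V} (h : Z.anc s t) (hp : Z.prio t ≤ Z.prio s) : s = t := by
  rcases h.eq_or_child with h | ⟨c, hc, hct⟩
  · exact h
  · have hss : Z.label t ⊂ Z.label s :=
      lt_of_le_of_lt hct.label_subset (label_ssubset_of_mem_children hc)
    have := Finset.card_lt_card (Finset.compl_ssubset_compl.mpr hss)
    exact absurd hp (not_le.mpr this)

theorem child_eq_of_anc {s c c' t : Z.V} (hc : c ∈ Z.children s) (hc' : c' ∈ Z.children s)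
    (h : Z.anc c t) (h' : Z.anc c' t) : c = c' := by
  have key : ∀ {c c' : Z.V}, c ∈ Z.children s → c' ∈ Z.children s → Z.anc c c' → c = c' := by
    intro c c' hc hc' hcc
    rcases Relation.ReflTransGen.cases_tail hcc with h | ⟨b, hb, hbc⟩
    · exact h.symm
    · rw [Z.parent_unique hbc hc'] at hb
      exact absurd (anc.label_subset hb) (label_ssubset_of_mem_children hc).2
  rcases h.total h' with h | h
  · exact key hc hc' h
  · exact (key hc' hc h).symm

theorem exists_leaf_below (s : Z.V) : ∃ t, Z.IsLeaf t ∧ Z.anc s t := by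
  induction hn : (Z.label s).card using Nat.strong_induction_on generalizing s with
  | _ n ih =>
    by_cases hs : Z.IsLeaf s
    · exact ⟨s, hs, .refl⟩
    · obtain ⟨c, hc⟩ := Finset.nonempty_iff_ne_empty.mpr hs
      obtain ⟨t, ht, hct⟩ := ih _
        (hn ▸ Finset.card_lt_card (label_ssubset_of_mem_children hc)) c rfl
      exact ⟨t, ht, anc.trans (.single hc) hct⟩

theorem sat_iff_of_not_subset_children {s : Z.V} {D : Finset C} (hD : D ⊆ Z.label s)
    (hc : ∀ c ∈ Z.children s, ¬ D ⊆ Z.label c) : ELSat (↑D) φ ↔ Z.Winning s := by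
  by_contra hne
  have hcand : ELCand φ (Z.label s) D := by
    refine ⟨hD.ssubset_of_ne ?_, by unfold Winning at hne; tauto⟩
    rintro rfl
    exact hne Iff.rfl
  obtain ⟨D', hDD', hmax⟩ :=
    (Set.toFinite {D' | ELCand φ (Z.label s) D'}).exists_le_maximal hcand
  obtain ⟨c, hcs, rfl⟩ := Z.child_exists (s := s) (D := D')
    ⟨hmax.1, fun D'' h'' hle => le_antisymm hle (hmax.2 h'' hle)⟩
  exact hc c hcs hDD'

/-- One step of the memory automaton of the Zielonka tree: on reading the colors `g` in the leaf
`m`, the automaton moves to a leaf `m'` below the anchor `s`, in the branch that follows, in the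
order given by `nxt`, the branch of `m`. -/
def Step (Z : ZielonkaTree C φ) (nxt : Z.V → Equiv.Perm Z.V) (g : Finset C) (m s m' : Z.V) :
    Prop :=
  Z.anc s m ∧ g ⊆ Z.label s ∧
    (∀ c ∈ Z.children s, Z.anc c m → ¬ g ⊆ Z.label c ∧ Z.anc (nxt s c) m') ∧ Z.anc s m'

theorem exists_step {nxt : Z.V → Equiv.Perm Z.V}
    (hnxt : ∀ s, (nxt s).IsCycleOn (Z.children s)) (g : Finset C) (m : Z.V) :
    ∃ s m', Z.IsLeaf m' ∧ Z.Step nxt g m s m' := by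
  obtain ⟨s, ⟨hsm, hgs⟩, hmin⟩ := Set.exists_min_image {s | Z.anc s m ∧ g ⊆ Z.label s}
    (fun s => (Z.label s).card) (Set.toFinite _)
    ⟨Z.root, Z.reach_root m, by rw [Z.root_label]; exact Finset.subset_univ _⟩
  have hc : ∀ c ∈ Z.children s, Z.anc c m → ¬ g ⊆ Z.label c := fun c hc hcm hg =>
    absurd (hmin c ⟨hcm, hg⟩) (not_le.mpr (Finset.card_lt_card (label_ssubset_of_mem_children hc)))
  by_cases h : ∃ c ∈ Z.children s, Z.anc c m
  · obtain ⟨c, hcs, hcm⟩ := h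
    obtain ⟨m', hm', hcm'⟩ := exists_leaf_below (nxt s c)
    have hn : nxt s c ∈ Z.children s := (hnxt s).1.mapsTo hcs
    refine ⟨s, m', hm', hsm, hgs, fun c' hc' hcm₂ => ⟨hc c' hc' hcm₂, ?_⟩,
      anc.trans (.single hn) hcm'⟩
    rwa [child_eq_of_anc hc' hcs hcm₂ hcm]
  · obtain ⟨m', hm', hsm'⟩ := exists_leaf_below s
    exact ⟨s, m', hm', hsm, hgs, fun c hc hcm => absurd ⟨c, hc, hcm⟩ h, hsm'⟩

theorem sat_iff_winning_of_frequently {nxt : Z.V → Equiv.Perm Z.V}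
    (hnxt : ∀ s, (nxt s).IsCycleOn (Z.children s)) {g : ℕ → Finset C} {m a : ℕ → Z.V}
    (hm : ∀ n, Z.IsLeaf (m n)) (hstep : ∀ n, Z.Step nxt (g n) (m n) (a n) (m (n + 1)))
    {s : Z.V} (hs : ∃ᶠ n in Filter.atTop, a n = s)
    (hp : ∀ᶠ n in Filter.atTop, Z.prio s ≤ Z.prio (a n)) :
    ELSat {c : C | ∀ M : ℕ, ∃ i ≥ M, c ∈ g i} φ ↔ Z.Winning s := by
  obtain ⟨N₀, hN₀⟩ := Filter.eventually_atTop.mp hp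
  rw [Filter.frequently_atTop] at hs
  obtain ⟨N, hNN₀, hN⟩ := hs N₀
  have below : ∀ n ≥ N, Z.anc s (a n) ∧ Z.anc s (m (n + 1)) := by
    intro n hn
    induction n, hn using Nat.le_induction with
    | base => exact ⟨hN ▸ .refl, hN ▸ (hstep N).2.2.2⟩
    | succ n hn ih =>
      have : Z.anc s (a (n + 1)) := by
        rcases ih.2.total (hstep (n + 1)).1 with h | h
        · exact h
        · rw [h.eq_of_prio_le (hN₀ _ (by omega))]
          exact .refl
      exact ⟨this, this.trans (hstep (n + 1)).2.2.2⟩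
  have stay : ∀ c ∈ Z.children s, ∀ n > N, Z.anc c (m n) →
      ∃ k ≥ n, Z.anc c (m k) ∧ a k = s := by
    intro c hc n hn hcn
    have h := hs n
    obtain ⟨hk, hks⟩ := Nat.find_spec h
    refine ⟨Nat.find h, hk, ?_, hks⟩
    have : ∀ j ≥ n, j ≤ Nat.find h → Z.anc c (m j) := by
      intro j hj
      induction j, hj using Nat.le_induction with
      | base => exact fun _ => hcn
      | succ j hj ih =>
        intro hjk
        have hcj := ih (by omega)
        have hne : a j ≠ s := fun hj' => Nat.find_min h (by omega) ⟨hj, hj'⟩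
        rcases (below j (by omega)).1.eq_or_child with h | ⟨c', hc', hca⟩
        · exact absurd h.symm hne
        · rw [child_eq_of_anc hc hc' hcj (hca.trans (hstep j).1)]
          exact hca.trans (hstep j).2.2.2
    exact this _ hk le_rfl
  have cycle : ∀ c ∈ Z.children s, ∀ n > N, Z.anc c (m n) → ∀ i : ℕ,
      ∃ k ≥ n, Z.anc (((nxt s) ^ i) c) (m k) := by
    intro c hc n hn hcn i
    induction i with
    | zero => exact ⟨n, le_rfl, hcn⟩
    | succ i ih =>
      obtain ⟨k, hk, hck⟩ := ih
      have hci : ((nxt s) ^ i) c ∈ Z.children s := ((hnxt s).1.perm_pow i).mapsTo hc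
      obtain ⟨l, hl, hcl, hal⟩ := stay _ hci k (by omega) hck
      refine ⟨l + 1, by omega, ?_⟩
      rw [pow_succ', Equiv.Perm.mul_apply]
      have := (hstep l).2.2.1
      rw [hal] at this
      exact (this _ hci hcl).2
  have leave : ∀ c ∈ Z.children s, ∀ M, ∃ n ≥ M, ¬ g n ⊆ Z.label c := by
    intro c hc M
    rcases (below (M + N) (by omega)).2.eq_or_child with h | ⟨c₀, hc₀, hcm⟩
    · have := hm (M + N + 1)
      rw [← h] at this
      rw [this] at hc
      simp at hc
    · obtain ⟨i, -, hi⟩ := (hnxt s).exists_pow_eq hc₀ hc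
      obtain ⟨k, hk, hck⟩ := cycle c₀ hc₀ (M + N + 1) (by omega) hcm i
      rw [hi] at hck
      obtain ⟨l, hl, hcl, hal⟩ := stay c hc k (by omega) hck
      have := (hstep l).2.2.1
      rw [hal] at this
      exact ⟨l, by omega, (this c hc hcl).1⟩
  set D : Finset C := (Set.toFinite {c : C | ∀ M : ℕ, ∃ i ≥ M, c ∈ g i}).toFinset with hD
  have hDc : (D : Set C) = {c : C | ∀ M : ℕ, ∃ i ≥ M, c ∈ g i} := by simp [hD]
  have memD : ∀ c, c ∈ D ↔ ∃ᶠ i in Filter.atTop, c ∈ g i := by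
    intro c
    simp [hD, Filter.frequently_atTop]
  rw [← hDc]
  apply sat_iff_of_not_subset_children
  · intro c hc
    obtain ⟨i, hi, hci⟩ := Filter.frequently_atTop.mp ((memD c).mp hc) N
    exact (below i hi).1.label_subset ((hstep i).2.1 hci)
  · intro c hc hsub
    have hfr : ∃ᶠ n in Filter.atTop, ∃ x, x ∈ g n ∧ x ∉ Z.label c := by
      rw [Filter.frequently_atTop]
      intro M
      obtain ⟨n, hn, h⟩ := leave c hc M
      exact ⟨n, hn, Finset.not_subset.mp h⟩
    obtain ⟨x, hx⟩ := Filter.frequently_exists.mp hfr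
    obtain ⟨_, _, hxc⟩ := hx.exists
    exact hxc (hsub ((memD x).mpr (hx.mono fun _ h => h.1)))

theorem not_sat_iff_exists_prio {nxt : Z.V → Equiv.Perm Z.V}
    (hnxt : ∀ s, (nxt s).IsCycleOn (Z.children s)) {g : ℕ → Finset C} {m a : ℕ → Z.V}
    (hm : ∀ n, Z.IsLeaf (m n)) (hstep : ∀ n, Z.Step nxt (g n) (m n) (a n) (m (n + 1))) :
    ¬ ELSat {c : C | ∀ M : ℕ, ∃ i ≥ M, c ∈ g i} φ ↔
      ∃ i, (∀ᶠ n in Filter.atTop, i ≤ Z.prio (a n)) ∧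
        ∃ᶠ n in Filter.atTop, Z.prio (a n) = i ∧ ¬ Z.Winning (a n) := by
  constructor
  · intro h
    have hne : {s | ∃ᶠ n in Filter.atTop, a n = s}.Nonempty :=
      Filter.frequently_exists.mp (Filter.Frequently.of_forall fun n => ⟨a n, rfl⟩)
    obtain ⟨s, hs, hmin⟩ := Set.exists_min_image _ Z.prio (Set.toFinite _) hne
    have hp : ∀ᶠ n in Filter.atTop, Z.prio s ≤ Z.prio (a n) := by
      have : ∀ t, ∀ᶠ n in Filter.atTop, a n = t → Z.prio s ≤ Z.prio t := by
        intro t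
        by_cases ht : ∃ᶠ n in Filter.atTop, a n = t
        · exact Filter.Eventually.of_forall fun _ _ => hmin t ht
        · exact (Filter.not_frequently.mp ht).mono fun n hn h => absurd h hn
      exact (Filter.eventually_all.mpr this).mono fun n hn => hn _ rfl
    rw [sat_iff_winning_of_frequently hnxt hm hstep hs hp] at h
    exact ⟨_, hp, hs.mono fun n hn => ⟨by rw [hn], by rwa [hn]⟩⟩
  · rintro ⟨i, hp, hf⟩
    have : ∃ᶠ n in Filter.atTop, ∃ s, a n = s ∧ Z.prio s = i ∧ ¬ Z.Winning s :=
      hf.mono fun n hn => ⟨_, rfl, hn⟩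
    obtain ⟨s, hs⟩ := Filter.frequently_exists.mp this
    obtain ⟨_, _, rfl, hw⟩ := hs.exists
    rwa [sat_iff_winning_of_frequently hnxt hm hstep (hs.mono fun _ h => h.1) hp]

theorem exists_equiv_label_initial (t : Z.V) :
    ∃ e : C ≃ Fin (Fintype.card C), ∀ s, Z.anc s t → ∀ x ∈ Z.label s, ∀ y ∉ Z.label s,
      e x < e y := by
  classical
  let f : C → ℕ := fun c => (Finset.univ.filter fun s => Z.anc s t ∧ c ∉ Z.label s).card
  let e₀ := Fintype.equivFin C
  let σ := Tuple.sort (f ∘ e₀.symm)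
  refine ⟨e₀.trans σ.symm, fun s hs x hx y hy => ?_⟩
  have hlt : f x < f y := by
    apply Finset.card_lt_card
    rw [Finset.ssubset_iff_of_subset]
    · exact ⟨s, by simp [hs, hy], by simp [hx]⟩
    · intro s' hs'
      simp only [Finset.mem_filter, Finset.mem_univ, true_and] at hs' ⊢
      refine ⟨hs'.1, fun hy' => ?_⟩
      rcases hs.total hs'.1 with h | h
      · exact hy (h.label_subset hy')
      · exact hs'.2 (h.label_subset hx)
  by_contra hle
  have := Tuple.monotone_sort (f ∘ e₀.symm) (not_lt.mp hle)
  simp [σ] at this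
  omega

theorem leaf_eq_of_label_initial {t t' : Z.V} (ht : Z.IsLeaf t) (ht' : Z.IsLeaf t')
    {e : C → Fin (Fintype.card C)}
    (he : ∀ s, Z.anc s t → ∀ x ∈ Z.label s, ∀ y ∉ Z.label s, e x < e y)
    (he' : ∀ s, Z.anc s t' → ∀ x ∈ Z.label s, ∀ y ∉ Z.label s, e x < e y) : t = t' := by
  have key : ∀ s, Z.anc Z.root s → Z.anc s t → Z.anc s t' := by
    intro s hs
    induction hs with
    | refl => exact fun _ => Z.reach_root t'
    | @tail b c hb hc ih =>
      intro hct
      rcases (ih (anc.trans (.single hc) hct)).eq_or_child with h | ⟨c', hc', hct'⟩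
      · subst h
        rw [ht'] at hc
        simp at hc
      · suffices c = c' by rwa [this]
        apply Z.child_label_inj hc hc'
        by_cases h : Z.label c ⊆ Z.label c'
        · exact (Z.child_maximal hc).2 _ (Z.child_maximal hc').1 h
        · obtain ⟨x, hx, hx'⟩ := Finset.not_subset.mp h
          refine ((Z.child_maximal hc').2 _ (Z.child_maximal hc).1 fun y hy => ?_).symm
          by_contra hy'
          exact lt_asymm (he c hct x hx y hy') (he' c' hct' y hy x hx')
  exact ht.eq_of_anc (key t (Z.reach_root t) .refl)

end ZielonkaTree

section Ranking

variable {T : Type} {step bad : T → T → Prop}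

/-- `RankRel step bad x' x` holds if some path of `step` with at least one step in `bad` leads
from `x` to `x'`. -/
def RankRel (step bad : T → T → Prop) (x' x : T) : Prop :=
  ∃ y y', Relation.ReflTransGen step x y ∧ bad y y' ∧ step y y' ∧ Relation.ReflTransGen step y' x'

theorem wellFounded_rankRel
    (h : ∀ y : ℕ → T, (∀ n, step (y n) (y (n + 1))) →
      ¬ ∃ᶠ n in Filter.atTop, bad (y n) (y (n + 1))) :
    WellFounded (RankRel step bad) := by
  by_contra hwf
  have hK : ∃ x, ¬ Acc (RankRel step bad) x := by
    by_contra hc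
    push Not at hc
    exact hwf ⟨hc⟩
  let L : ℕ → T → Prop := fun n => Nat.rec
    (fun x => ∃ y', step x y' ∧ bad x y' ∧ ¬ Acc (RankRel step bad) y')
    (fun _ ih x => ∃ x', step x x' ∧ ih x') n
  have hL : ∀ x, ¬ Acc (RankRel step bad) x → ∃ n, L n x := by
    intro x hx
    obtain ⟨z, ⟨y, y', hxy, hy, hyy', hyz⟩, hz⟩ :
        ∃ z, RankRel step bad z x ∧ ¬ Acc (RankRel step bad) z := by
      by_contra hc
      push Not at hc
      exact hx ⟨_, hc⟩
    have hy' : ¬ Acc (RankRel step bad) y' := fun hacc => hz <| by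
      refine ⟨_, fun w hw => ?_⟩
      obtain ⟨a, b, h₁, h₂⟩ := hw
      exact hacc.inv ⟨a, b, hyz.trans h₁, h₂⟩
    clear hx
    induction hxy using Relation.ReflTransGen.head_induction_on with
    | refl => exact ⟨0, y', hyy', hy, hy'⟩
    | head hab _ ih =>
      obtain ⟨n, hn⟩ := ih
      exact ⟨n + 1, _, hab, hn⟩
  let S := {p : T × ℕ // L p.2 p.1}
  have hS : ∀ p : S, ∃ q : S, step p.1.1 q.1.1 ∧ (p.1.2 = 0 → bad p.1.1 q.1.1) ∧
      (p.1.2 ≠ 0 → q.1.2 + 1 = p.1.2) := by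
    rintro ⟨⟨x, n⟩, hx⟩
    cases n with
    | zero =>
      obtain ⟨y', hs, hb, hy'⟩ := hx
      obtain ⟨n, hn⟩ := hL y' hy'
      exact ⟨⟨(y', n), hn⟩, hs, fun _ => hb, fun h => absurd rfl h⟩
    | succ n =>
      obtain ⟨x', hs, hx'⟩ := hx
      exact ⟨⟨(x', n), hx'⟩, hs, fun h => absurd h (Nat.succ_ne_zero n), fun _ => rfl⟩
  choose nx hnx using hS
  obtain ⟨x₀, hx₀⟩ := hK
  obtain ⟨n₀, hn₀⟩ := hL x₀ hx₀
  let y : ℕ → S := fun n => nx^[n] ⟨(x₀, n₀), hn₀⟩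
  have hy : ∀ n, y (n + 1) = nx (y n) := fun n => Function.iterate_succ_apply' nx n _
  refine h (fun n => (y n).1.1) (fun n => ?_) ?_
  · rw [hy]
    exact (hnx (y n)).1
  · rw [Filter.frequently_atTop]
    have : ∀ k M, (y M).1.2 = k → ∃ n ≥ M, bad (y n).1.1 (y (n + 1)).1.1 := by
      intro k
      induction k with
      | zero => exact fun M hM => ⟨M, le_rfl, by rw [hy]; exact (hnx (y M)).2.1 hM⟩
      | succ k ih =>
        intro M hM
        have := (hnx (y M)).2.2 (by omega)
        rw [← hy] at this
        obtain ⟨n, hn, hb⟩ := ih (M + 1) (by omega)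
        exact ⟨n, by omega, hb⟩
    exact fun M => this _ M rfl

theorem exists_ordinal_ranking
    (h : ∀ y : ℕ → T, (∀ n, step (y n) (y (n + 1))) →
      ¬ ∃ᶠ n in Filter.atTop, bad (y n) (y (n + 1))) :
    ∃ o : T → Ordinal.{0}, ∀ x x', step x x' → o x' ≤ o x ∧ (bad x x' → o x' < o x) := by
  have : IsWellFounded T (RankRel step bad) := ⟨wellFounded_rankRel h⟩
  refine ⟨IsWellFounded.rank (RankRel step bad), fun x x' hs => ⟨?_, fun hb => ?_⟩⟩
  · rw [IsWellFounded.rank_eq (RankRel step bad) x']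
    apply Ordinal.iSup_le
    rintro ⟨z, a, b, h₁, h₂⟩
    exact Order.succ_le_of_lt (IsWellFounded.rank_lt_of_rel ⟨a, b, .head hs h₁, h₂⟩)
  · exact IsWellFounded.rank_lt_of_rel ⟨x, x', .refl, hb, hs, .refl⟩

theorem not_frequently_lt_of_eventually_le {α : Type*} [LinearOrder α] [WellFoundedLT α]
    {a : ℕ → α} (hle : ∀ᶠ n in Filter.atTop, a (n + 1) ≤ a n) :
    ¬ ∃ᶠ n in Filter.atTop, a (n + 1) < a n := by
  intro hlt
  obtain ⟨N, hN⟩ := Filter.eventually_atTop.mp hle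
  obtain ⟨_, ⟨k, hk, rfl⟩, hmin⟩ :=
    WellFounded.has_min (wellFounded_lt (α := α)) (a '' Set.Ici N) ⟨_, N, Set.self_mem_Ici, rfl⟩
  have hanti : ∀ n ≥ k, a n ≤ a k := by
    intro n hn
    induction n, hn using Nat.le_induction with
    | base => exact le_rfl
    | succ n hn ih => exact (hN n (le_trans hk hn)).trans ih
  obtain ⟨n, hn, h⟩ := Filter.frequently_atTop.mp hlt k
  exact hmin _ ⟨n + 1, Set.mem_Ici.mpr (by have := Set.mem_Ici.mp hk; omega), rfl⟩
    (h.trans_le (hanti n hn))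

/-- The components of a tuple of ordinals up to `i`, the others being set to zero. -/
def truncate {k : ℕ} (i : Fin k) (f : Lex (Fin k → Ordinal.{0})) : Lex (Fin k → Ordinal.{0}) :=
  toLex fun j => if j ≤ i then ofLex f j else 0

theorem truncate_mono {k : ℕ} (i : Fin k) : Monotone (truncate i) := by
  intro f g hfg
  rcases hfg.eq_or_lt with rfl | ⟨j, hj, hlt⟩
  · exact le_rfl
  · by_cases hji : j ≤ i
    · refine le_of_lt ⟨j, fun l hl => ?_, ?_⟩
      · have := hj l hl
        simp only [truncate]
        change (if l ≤ i then f l else 0) = if l ≤ i then g l else 0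
        simp only [this]
      · change (if j ≤ i then f j else 0) < if j ≤ i then g j else 0
        simpa only [if_pos hji] using hlt
    · refine le_of_eq ?_
      unfold truncate
      congr 1
      funext l
      by_cases hl : l ≤ i
      · simp only [if_pos hl]
        exact hj l (hl.trans_lt (not_le.mp hji))
      · simp only [if_neg hl]

end Ranking

section Games

variable {N M : Type}

/-- The sequence of memory values before each node of `π` is read. -/
def memBefore (upd : M → N → M) (m₀ : M) (π : ℕ → N) : ℕ → M
  | 0 => m₀
  | n + 1 => upd (memBefore upd m₀ π n) (π n)

theorem foldl_range_map_eq_memBefore (upd : M → N → M) (m₀ : M) (π : ℕ → N) (n : ℕ) :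
    List.foldl upd m₀ ((List.range n).map π) = memBefore upd m₀ π n := by
  induction n with
  | zero => rfl
  | succ n ih => simp [List.range_succ, memBefore, ih]

/-- A min-parity-like condition that is violated along a sequence: for some `i`, eventually all
priorities are at least `i`, and infinitely often the priority is `i` at a bad index. -/
def ParityViolated (P : ℕ → ℕ) (B : ℕ → Prop) : Prop :=
  ∃ i, (∀ᶠ n in Filter.atTop, i ≤ P n) ∧ ∃ᶠ n in Filter.atTop, P n = i ∧ B n

theorem parityViolated_succ {P : ℕ → ℕ} {B : ℕ → Prop} :
    ParityViolated (fun n => P (n + 1)) (fun n => B (n + 1)) ↔ ParityViolated P B := by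
  unfold ParityViolated
  refine exists_congr fun i => and_congr ?_ ?_
  · rw [← Filter.eventually_map (m := (· + 1)) (P := fun n => i ≤ P n),
      Filter.map_add_atTop_eq_nat]
  · rw [← Filter.frequently_map (m := (· + 1)) (P := fun n => P n = i ∧ B n),
      Filter.map_add_atTop_eq_nat]

/-- The edges of the tree of histories compliant with `σ`; a history is a pair of the past nodes
and the current node. -/
def HistEdge (A : Arena N) (σ : List N → N → N) (x y : List N × N) : Prop :=
  y.1 = x.1 ++ [x.2] ∧ y.2 ∈ A.E x.2 ∧ (x.2 ∈ A.Vex → y.2 = σ x.1 x.2)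

/-- A graph all of whose infinite paths satisfy a min-parity-like condition has a ranking by tuples
of ordinals. -/
theorem exists_lex_ranking {T : Type} {edge : T → T → Prop} (k : ℕ) {P : T → ℕ} {B : T → Prop}
    (h : ∀ y : ℕ → T, (∀ n, edge (y n) (y (n + 1))) →
      ¬ ParityViolated (fun n => P (y n)) (fun n => B (y n))) :
    ∃ ρ : T → Lex (Fin k → Ordinal.{0}), ∀ x x', edge x x' → ∀ i : Fin k, (i : ℕ) ≤ P x' →
      truncate i (ρ x') ≤ truncate i (ρ x) ∧
        (P x' = i → B x' → truncate i (ρ x') < truncate i (ρ x)) := by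
  have hrank : ∀ i : Fin k, ∃ o : T → Ordinal.{0}, ∀ x x', (edge x x' ∧ (i : ℕ) ≤ P x') →
      o x' ≤ o x ∧ ((P x' = i ∧ B x') → o x' < o x) := fun i =>
    exists_ordinal_ranking (step := fun x x' => edge x x' ∧ (i : ℕ) ≤ P x')
      (bad := fun _ x' => P x' = i ∧ B x') fun y hy hf =>
        h y (fun n => (hy n).1) <| parityViolated_succ.mp
          ⟨i, Filter.Eventually.of_forall fun n => (hy n).2, hf⟩
  choose o ho using hrank
  refine ⟨fun x => toLex fun i => o i x, fun x x' he i hi => ?_⟩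
  have hle : (fun j => if j ≤ i then o j x' else 0) ≤ fun j => if j ≤ i then o j x else 0 := by
    intro j
    by_cases hj : j ≤ i
    · simpa only [if_pos hj] using (ho j x x' ⟨he, le_trans (Fin.le_def.mp hj) hi⟩).1
    · simp only [if_neg hj, le_refl]
  refine ⟨Pi.toLex_monotone hle, fun hP hB => Pi.toLex_strictMono ?_⟩
  refine lt_of_le_not_ge hle fun hge => ?_
  have := hge i
  simp only [le_refl, if_true] at this
  exact absurd this (not_le.mpr ((ho i x x' ⟨he, hi⟩).2 ⟨hP, hB⟩))

/-- If the complement of an objective is recognized, by a deterministic memory structure, through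
a min-parity-like condition, then winning strategies can be chosen to use that memory only. -/
theorem fmWinsFrom_of_winsFrom {A : Arena N} {α : (ℕ → N) → Prop} (upd : M → N → M) (m₀ : M)
    {k : ℕ} (P : M → N → ℕ) (hPk : ∀ m u, P m u < k) (B : M → N → Prop)
    (hα : ∀ π, ¬ α π ↔ ParityViolated (fun n => P (memBefore upd m₀ π n) (π n))
      (fun n => B (memBefore upd m₀ π n) (π n)))
    {v : N} (hv : WinsFrom A α v) : FMWinsFrom A α M v := by
  classical
  obtain ⟨σ, hσ, hwin⟩ := hv
  let T := List N × N
  let mem : T → M := fun x => x.1.foldl upd m₀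
  let R : T → Prop := Relation.ReflTransGen (HistEdge A σ) ([], v)
  let PT : T → ℕ := fun x => P (mem x) x.2
  let BT : T → Prop := fun x => B (mem x) x.2
  have good : ∀ x, R x → ∀ y : ℕ → T, y 0 = x → (∀ n, HistEdge A σ (y n) (y (n + 1))) →
      ¬ ParityViolated (fun n => PT (y n)) (fun n => BT (y n)) := by
    intro x hx
    induction hx with
    | refl =>
      intro y hy0 hy
      have hhist : ∀ n, (y n).1 = (List.range n).map fun i => (y i).2 := by
        intro n
        induction n with
        | zero => simp [hy0]
        | succ n ih => rw [(hy n).1, ih]; simp [List.range_succ]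
      have hw := hwin (fun i => (y i).2) (fun i => (hy i).2.1) (by simp [hy0])
        (fun i hi => by rw [← hhist]; exact (hy i).2.2 hi)
      rw [← not_not (a := α _), hα] at hw
      simpa only [PT, BT, mem, hhist, foldl_range_map_eq_memBefore] using hw
    | @tail b c _ hbc ih =>
      intro y hy0 hy hbad
      refine ih (fun n => Nat.casesOn n b y) rfl (fun n => ?_)
        (parityViolated_succ.mp hbad)
      cases n with
      | zero => simpa [hy0] using hbc
      | succ n => exact hy n
  obtain ⟨ρ, hρ⟩ := exists_lex_ranking (T := {x // R x})
    (edge := fun x y => HistEdge A σ x.1 y.1) k (P := fun x => PT x.1) (B := fun x => BT x.1)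
    fun y hy => good _ (y 0).2 (fun n => (y n).1) rfl hy
  let H : N → M → Set {x // R x} := fun u m => {x | x.1.2 = u ∧ upd (mem x.1) u = m}
  have hmin : ∀ u m, ∃ x : {x // R x}, (H u m).Nonempty → x ∈ H u m ∧ ∀ z ∈ H u m, ρ x ≤ ρ z := by
    intro u m
    by_cases h : (H u m).Nonempty
    · obtain ⟨_, ⟨x, hx, rfl⟩, hm⟩ := WellFounded.has_min
        (wellFounded_lt (α := Lex (Fin k → Ordinal.{0}))) (ρ '' H u m) (h.image ρ)
      exact ⟨x, fun _ => ⟨hx, fun z hz => not_lt.mp (hm _ ⟨z, hz, rfl⟩)⟩⟩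
    · exact ⟨⟨([], v), .refl⟩, fun h' => absurd h' h⟩
  choose best hbest using hmin
  refine ⟨⟨m₀, upd, fun u m => σ (best u m).1.1 u, fun u m hu => hσ _ u hu⟩,
    fun π hπ hπ0 hcomp => ?_⟩
  let μ : ℕ → M := memBefore upd m₀ π
  have hcomp' : ∀ n, π n ∈ A.Vex → π (n + 1) = σ (best (π n) (μ (n + 1))).1.1 (π n) := by
    intro n hn
    have := hcomp n hn
    rwa [FMStrategy.memAt, foldl_range_map_eq_memBefore] at this
  have hnext : ∀ n, (H (π n) (μ (n + 1))).Nonempty →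
      ∃ z ∈ H (π (n + 1)) (μ (n + 2)), HistEdge A σ (best (π n) (μ (n + 1))).1 z.1 ∧
        PT z.1 = P (μ (n + 1)) (π (n + 1)) ∧ BT z.1 = B (μ (n + 1)) (π (n + 1)) := by
    intro n hn
    obtain ⟨⟨hu, hm⟩, -⟩ := hbest _ _ hn
    generalize hx : best (π n) (μ (n + 1)) = x at hu hm
    have hcx := hcomp' n
    rw [hx] at hcx
    have he : HistEdge A σ x.1 (x.1.1 ++ [x.1.2], π (n + 1)) :=
      ⟨rfl, hu ▸ hπ n, fun h => by rw [hu] at h ⊢; exact hcx h⟩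
    have hmem : mem (x.1.1 ++ [x.1.2], π (n + 1)) = μ (n + 1) := by
      simp only [mem, List.foldl_append, List.foldl_cons, List.foldl_nil]
      rw [← hm, hu]
    refine ⟨⟨_, x.2.tail he⟩, ⟨rfl, ?_⟩, he, ?_, ?_⟩
    · rw [hmem]
      rfl
    · simp only [PT, hmem]
    · simp only [BT, hmem]
  have hne : ∀ n, (H (π n) (μ (n + 1))).Nonempty := by
    intro n
    induction n with
    | zero => exact ⟨⟨([], v), .refl⟩, hπ0.symm, rfl⟩
    | succ n ih =>
      obtain ⟨z, hz, -⟩ := hnext n ih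
      exact ⟨z, hz⟩
  by_contra hbad
  rw [hα, ← parityViolated_succ] at hbad
  obtain ⟨i, hle, hfr⟩ := hbad
  obtain ⟨n₀, hn₀, -⟩ := hfr.exists
  have hik : i < k := hn₀ ▸ hPk _ _
  let a : ℕ → Lex (Fin k → Ordinal.{0}) := fun n =>
    truncate ⟨i, hik⟩ (ρ (best (π n) (μ (n + 1))))
  have hstep : ∀ n, i ≤ P (μ (n + 1)) (π (n + 1)) → a (n + 1) ≤ a n ∧
      (P (μ (n + 1)) (π (n + 1)) = i → B (μ (n + 1)) (π (n + 1)) → a (n + 1) < a n) := by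
    intro n hn
    obtain ⟨z, hz, he, hPz, hBz⟩ := hnext n (hne n)
    have hmono := truncate_mono ⟨i, hik⟩ ((hbest _ _ (hne (n + 1))).2 z hz)
    have hz' := hρ _ z he ⟨i, hik⟩ (by rw [hPz]; exact hn)
    rw [hPz, hBz] at hz'
    exact ⟨hmono.trans hz'.1, fun h₁ h₂ => hmono.trans_lt (hz'.2 h₁ h₂)⟩
  exact not_frequently_lt_of_eventually_le (hle.mono fun n hn => (hstep n hn).1)
    (hfr.mono fun n hn => (hstep n hn.1.ge).2 hn.1 hn.2)

end Games

/-- In an Emerson-Lei game with `k = |C|` colors, every node in the winning region of the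
existential player is won by a finite-memory strategy whose memory set is the set `L` of
leaves of the Zielonka tree `Z_φ`; moreover `|L| ≤ k!`, so memory `k!` suffices. -/
theorem winning_implies_finite_memory_leaves
    {C N : Type} [Fintype C] [DecidableEq C] (φ : ELFormula C) (Z : ZielonkaTree C φ)
    (A : Arena N) (γ : N → Finset C) :
    letI : Fintype Z.V := Z.finV
    letI : DecidableEq Z.V := Z.decV
    letI : DecidablePred Z.IsLeaf := fun t => decidable_of_iff (Z.children t = ∅) Iff.rfl
    (∀ v : N, WinsFrom A (ELObjective γ φ) v →
        FMWinsFrom A (ELObjective γ φ) {t : Z.V // Z.IsLeaf t} v) ∧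
    Fintype.card {t : Z.V // Z.IsLeaf t} ≤ Nat.factorial (Fintype.card C) := by
  classical
  constructor
  · intro v hv
    choose nxt hnxt using fun s => (Z.children s).exists_cycleOn
    choose anchor next hleaf hstep using
      fun (g : Finset C) (m : Z.V) => ZielonkaTree.exists_step (fun s => (hnxt s).1) g m
    obtain ⟨l₀, hl₀, -⟩ := ZielonkaTree.exists_leaf_below Z.root
    refine fmWinsFrom_of_winsFrom (fun m u => ⟨next (γ u) m.1, hleaf _ _⟩) ⟨l₀, hl₀⟩
      (k := Fintype.card C + 1) (fun m u => Z.prio (anchor (γ u) m.1))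
      (fun _ _ => Nat.lt_succ_of_le (Finset.card_le_univ _))
      (fun m u => ¬ Z.Winning (anchor (γ u) m.1)) (fun π => ?_) hv
    exact ZielonkaTree.not_sat_iff_exists_prio (fun s => (hnxt s).1)
      (m := fun n => (memBefore (fun m u => (⟨next (γ u) m.1, hleaf _ _⟩ : {t // Z.IsLeaf t}))
        ⟨l₀, hl₀⟩ π n).1)
      (fun n => Subtype.prop _) (fun n => hstep (γ (π n)) _)
  · choose e he using fun t => ZielonkaTree.exists_equiv_label_initial (Z := Z) t
    have hinj : Function.Injective
        fun t : {t : Z.V // Z.IsLeaf t} => e t.1 := fun t t' h =>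
      Subtype.ext <| ZielonkaTree.leaf_eq_of_label_initial t.2 t'.2 (he t.1)
        (by rw [show e t.1 = e t'.1 from h]; exact he t'.1)
    calc _ = Nat.card {t : Z.V // Z.IsLeaf t} := (Fintype.card_eq_nat_card ..)
      _ ≤ Nat.card (C ≃ Fin (Fintype.card C)) := Nat.card_le_card_of_injective _ hinj
      _ = _ := by
        rw [Nat.card_eq_fintype_card, Fintype.card_equiv (Fintype.equivFin C)]
end

section
/- Every safety LTL formula defines a safety language: if φ is an LTL formula in negative normal form using only the temporal operators X, R and G, and w ∈ (2^AP)^ω does not satisfy φ, then there exists n ∈ ℕ such that every word w' ∈ (2^AP)^ω agreeing with w on its first n letters also does not satisfy φ. -/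
/-- LTL formulas over atomic propositions `AP`, built from `⊤`, `⊥`, atoms, negation,
conjunction, disjunction and the temporal operators `X` (next), `U` (until),
`R` (release, the dual of until), `F` (eventually) and `G` (globally). -/
inductive LTL (AP : Type) : Type
  | tt : LTL AP
  | ff : LTL AP
  | atom : AP → LTL AP
  | not : LTL AP → LTL AP
  | and : LTL AP → LTL AP → LTL AP
  | or : LTL AP → LTL AP → LTL AP
  | next : LTL AP → LTL AP
  | untl : LTL AP → LTL AP → LTL AP
  | release : LTL AP → LTL AP → LTL AP
  | ev : LTL AP → LTL AP
  | glob : LTL AP → LTL AP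

/-- The usual satisfaction relation of LTL over infinite words `w ∈ (2^AP)^ω`;
`release` is the dual of `untl`: `φ R ψ = ¬(¬φ U ¬ψ)`. -/
def LTLSat {AP : Type} (w : ℕ → Set AP) : LTL AP → Prop
  | .tt => True
  | .ff => False
  | .atom p => p ∈ w 0
  | .not f => ¬ LTLSat w f
  | .and f g => LTLSat w f ∧ LTLSat w g
  | .or f g => LTLSat w f ∨ LTLSat w g
  | .next f => LTLSat (fun n => w (n + 1)) f
  | .untl f g => ∃ i : ℕ, LTLSat (fun n => w (n + i)) g ∧
      ∀ j < i, LTLSat (fun n => w (n + j)) f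
  | .release f g => ∀ i : ℕ, LTLSat (fun n => w (n + i)) g ∨
      ∃ j < i, LTLSat (fun n => w (n + j)) f
  | .ev f => ∃ i : ℕ, LTLSat (fun n => w (n + i)) f
  | .glob f => ∀ i : ℕ, LTLSat (fun n => w (n + i)) f

/-- Safety LTL formulas: formulas in negative normal form (negation applied only to
atomic propositions) using only the temporal operators `X`, `R` and `G`
(no `U` and no `F`). -/
def IsSafety {AP : Type} : LTL AP → Prop
  | .tt => True
  | .ff => True
  | .atom _ => True
  | .not (.atom _) => True
  | .not _ => False
  | .and f g => IsSafety f ∧ IsSafety g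
  | .or f g => IsSafety f ∧ IsSafety g
  | .next f => IsSafety f
  | .untl _ _ => False
  | .release f g => IsSafety f ∧ IsSafety g
  | .ev _ => False
  | .glob f => IsSafety f

/-- `HoldsNear w P` says that some finite prefix of `w` guarantees the property `P`. -/
def HoldsNear {α : Type*} (w : ℕ → α) (P : (ℕ → α) → Prop) : Prop :=
  ∃ n : ℕ, ∀ w' : ℕ → α, (∀ i < n, w' i = w i) → P w'

namespace HoldsNear

variable {α : Type*} {w : ℕ → α} {P Q : (ℕ → α) → Prop}

theorem mono (h : HoldsNear w P) (hPQ : ∀ w', P w' → Q w') : HoldsNear w Q :=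
  h.imp fun _ hn w' hw' => hPQ w' (hn w' hw')

theorem and (hP : HoldsNear w P) (hQ : HoldsNear w Q) :
    HoldsNear w fun w' => P w' ∧ Q w' := by
  obtain ⟨m, hm⟩ := hP
  obtain ⟨n, hn⟩ := hQ
  exact ⟨max m n, fun w' h =>
    ⟨hm w' fun i hi => h i (lt_max_of_lt_left hi), hn w' fun i hi => h i (lt_max_of_lt_right hi)⟩⟩

theorem shift {k : ℕ} (h : HoldsNear (fun n => w (n + k)) P) :
    HoldsNear w fun w' => P fun n => w' (n + k) := by
  obtain ⟨n, hn⟩ := h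
  exact ⟨n + k, fun w' hw' => hn _ fun i hi => hw' (i + k) (by omega)⟩

theorem forall_lt {P : ℕ → (ℕ → α) → Prop} (k : ℕ) (h : ∀ j < k, HoldsNear w (P j)) :
    HoldsNear w fun w' => ∀ j < k, P j w' := by
  induction k with
  | zero => exact ⟨0, fun _ _ j hj => absurd hj (Nat.not_lt_zero j)⟩
  | succ k ih =>
    exact ((ih fun j hj => h j (by omega)).and (h k (by omega))).mono fun w' hw' j hj =>
      (Nat.lt_succ_iff_lt_or_eq.mp hj).elim (hw'.1 j) fun hjk => hjk ▸ hw'.2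

theorem of_apply_zero {p : α → Prop} (h : p (w 0)) : HoldsNear w fun w' => p (w' 0) :=
  ⟨1, fun _ hw' => (congrArg p (hw' 0 one_pos)).mpr h⟩

end HoldsNear

theorem IsSafety.holdsNear_not_sat {AP : Type} {φ : LTL AP} (hφ : IsSafety φ)
    {w : ℕ → Set AP} (hw : ¬ LTLSat w φ) : HoldsNear w fun w' => ¬ LTLSat w' φ := by
  induction φ generalizing w with
  | tt => exact absurd trivial hw
  | ff => exact ⟨0, fun _ _ h => h⟩
  | atom p => exact HoldsNear.of_apply_zero (p := fun s => ¬ p ∈ s) hw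
  | not f _ =>
    cases f with
    | atom p => exact HoldsNear.of_apply_zero (p := fun s => ¬ ¬ p ∈ s) hw
    | _ => exact hφ.elim
  | and f g ihf ihg =>
    by_cases hf : LTLSat w f
    · exact (ihg hφ.2 fun hg => hw ⟨hf, hg⟩).mono fun _ h h' => h h'.2
    · exact (ihf hφ.1 hf).mono fun _ h h' => h h'.1
  | or f g ihf ihg =>
    exact ((ihf hφ.1 fun h => hw (.inl h)).and (ihg hφ.2 fun h => hw (.inr h))).mono
      fun _ h h' => h'.elim h.1 h.2
  | next f ih => exact (ih hφ hw).shift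
  | untl f g _ _ => exact hφ.elim
  | release f g ihf ihg =>
    obtain ⟨i, hi⟩ := not_forall.mp hw
    have hg := (ihg hφ.2 fun h => hi (.inl h)).shift
    have hf := HoldsNear.forall_lt i fun j hj =>
      (ihf hφ.1 fun h => hi (.inr ⟨j, hj, h⟩)).shift
    exact (hg.and hf).mono fun _ h h' =>
      (h' i).elim h.1 fun ⟨j, hj, hs⟩ => h.2 j hj hs
  | ev f _ => exact hφ.elim
  | glob f ih =>
    obtain ⟨i, hi⟩ := not_forall.mp hw
    exact (ih hφ hi).shift.mono fun _ h h' => h (h' i)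

/-- Every safety LTL formula defines a safety language: if `φ` is in negative normal form
and uses only the temporal operators `X`, `R`, `G`, and the word `w` does not satisfy
`φ`, then some finite prefix of `w` already falsifies `φ`: there is `n` such that every
word agreeing with `w` on its first `n` letters also does not satisfy `φ`. -/
theorem safety_formula_defines_safety_language
    {AP : Type} [Fintype AP] (φ : LTL AP) (hφ : IsSafety φ)
    (w : ℕ → Set AP) (hw : ¬ LTLSat w φ) :
    ∃ n : ℕ, ∀ w' : ℕ → Set AP, (∀ i < n, w' i = w i) → ¬ LTLSat w' φ :=
  hφ.holdsNear_not_sat hw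
end

section
/- For every safety LTL formula φ there exists a deterministic symbolic safety automaton D over a set of variables of size at most 2^{|φ|} (equivalently, a deterministic safety automaton with at most 2^{2^{|φ|}} states) whose language equals the language of φ: L(D) = L(φ). -/
/-- The size of an LTL formula (its number of subformula occurrences). -/
def LTL.size {AP : Type} : LTL AP → ℕ
  | .tt => 1
  | .ff => 1
  | .atom _ => 1
  | .not f => f.size + 1
  | .and f g => f.size + g.size + 1
  | .or f g => f.size + g.size + 1
  | .next f => f.size + 1
  | .untl f g => f.size + g.size + 1
  | .release f g => f.size + g.size + 1
  | .ev f => f.size + 1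
  | .glob f => f.size + 1

/-- A symbolic safety automaton `A = (2^AP, V, T, θ₀)`: a finite set `Var` of Boolean
variables, an initialization assertion on variable assignments, and a transition
assertion relating an assignment, a successor assignment, and a letter. -/
structure SymbSafetyAut (AP : Type) where
  Var : Type
  [finVar : Fintype Var]
  init : Set Var → Prop
  trans : Set Var → Set Var → Set AP → Prop

attribute [instance] SymbSafetyAut.finVar

/-- A run of a symbolic safety automaton on a word: an infinite sequence of variable
assignments starting in an initial assignment and following the transition assertion. -/
def SymbSafetyAut.IsRun {AP : Type} (D : SymbSafetyAut AP)
    (w : ℕ → Set AP) (ρ : ℕ → Set D.Var) : Prop :=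
  D.init (ρ 0) ∧ ∀ i, D.trans (ρ i) (ρ (i + 1)) (w i)

/-- The language of a symbolic safety automaton: the words on which an infinite run
exists. -/
def SymbSafetyAut.Lang {AP : Type} (D : SymbSafetyAut AP) : Set (ℕ → Set AP) :=
  {w | ∃ ρ : ℕ → Set D.Var, D.IsRun w ρ}

/-- A symbolic safety automaton is deterministic if it has at most one initial assignment
and at most one successor assignment for each assignment and letter. -/
def SymbSafetyAut.Deterministic {AP : Type} (D : SymbSafetyAut AP) : Prop :=
  (∀ s s' : Set D.Var, D.init s → D.init s' → s = s') ∧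
  ∀ (s s₁ s₂ : Set D.Var) (a : Set AP), D.trans s s₁ a → D.trans s s₂ a → s₁ = s₂

open Filter

namespace LTL

variable {AP : Type}

theorem sat_untl_iff (w : ℕ → Set AP) (f g : LTL AP) :
    LTLSat w (.untl f g) ↔
      LTLSat w g ∨ (LTLSat w f ∧ LTLSat (fun n => w (n + 1)) (.untl f g)) := by
  simp only [LTLSat]
  rw [← Nat.or_exists_add_one]
  simp only [Nat.forall_lt_succ_left, Nat.not_lt_zero, false_imp_iff, implies_true, and_true,
    Nat.add_zero, and_left_comm, exists_and_left, Nat.add_assoc]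

theorem sat_release_iff (w : ℕ → Set AP) (f g : LTL AP) :
    LTLSat w (.release f g) ↔
      LTLSat w g ∧ (LTLSat w f ∨ LTLSat (fun n => w (n + 1)) (.release f g)) := by
  simp only [LTLSat]
  rw [← Nat.and_forall_add_one]
  simp only [Nat.exists_lt_succ_left, Nat.not_lt_zero, false_and, exists_false, or_false,
    Nat.add_zero, or_left_comm, forall_or_left, Nat.add_assoc]

theorem sat_ev_iff (w : ℕ → Set AP) (f : LTL AP) :
    LTLSat w (.ev f) ↔ LTLSat w f ∨ LTLSat (fun n => w (n + 1)) (.ev f) :=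
  (Nat.or_exists_add_one (p := fun i => LTLSat (fun n => w (n + i)) f)).symm

theorem sat_glob_iff (w : ℕ → Set AP) (f : LTL AP) :
    LTLSat w (.glob f) ↔ LTLSat w f ∧ LTLSat (fun n => w (n + 1)) (.glob f) :=
  (Nat.and_forall_add_one (p := fun i => LTLSat (fun n => w (n + i)) f)).symm

/-- The subformula occurrences of a formula. -/
def subformulas : LTL AP → List (LTL AP)
  | .tt => [.tt]
  | .ff => [.ff]
  | .atom p => [.atom p]
  | .not f => .not f :: f.subformulas
  | .and f g => .and f g :: (f.subformulas ++ g.subformulas)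
  | .or f g => .or f g :: (f.subformulas ++ g.subformulas)
  | .next f => .next f :: f.subformulas
  | .untl f g => .untl f g :: (f.subformulas ++ g.subformulas)
  | .release f g => .release f g :: (f.subformulas ++ g.subformulas)
  | .ev f => .ev f :: f.subformulas
  | .glob f => .glob f :: f.subformulas

theorem length_subformulas (φ : LTL AP) : φ.subformulas.length = φ.size := by
  induction φ <;> simp_all [subformulas, size]

theorem self_mem_subformulas (φ : LTL AP) : φ ∈ φ.subformulas := by
  cases φ <;> simp [subformulas]

/-- Prepend a letter to a word. -/
def consWord (a : Set AP) (x : ℕ → Set AP) : ℕ → Set AP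
  | 0 => a
  | n + 1 => x n

theorem sat_consWord_congr (a : Set AP) {x y : ℕ → Set AP} (φ : LTL AP)
    (h : ∀ ψ ∈ φ.subformulas, LTLSat x ψ ↔ LTLSat y ψ) :
    LTLSat (consWord a x) φ ↔ LTLSat (consWord a y) φ := by
  have tail (z : ℕ → Set AP) : (fun n => consWord a z (n + 1)) = z := rfl
  have hφ := h φ φ.self_mem_subformulas
  induction φ with
  | tt | ff | atom => rfl
  | not f ihf =>
    have hf := ihf (fun ψ hψ => h ψ (by simp [subformulas, hψ]))
      (h f (by simp [subformulas, self_mem_subformulas]))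
    simp only [LTLSat, hf]
  | next f => exact h f (by simp [subformulas, self_mem_subformulas])
  | ev f ihf | glob f ihf =>
    have hf := ihf (fun ψ hψ => h ψ (by simp [subformulas, hψ]))
      (h f (by simp [subformulas, self_mem_subformulas]))
    simp only [sat_ev_iff (consWord a _), sat_glob_iff (consWord a _), tail, hf, hφ]
  | and f g ihf ihg | or f g ihf ihg | untl f g ihf ihg | release f g ihf ihg =>
    have hf := ihf (fun ψ hψ => h ψ (by simp [subformulas, hψ]))
      (h f (by simp [subformulas, self_mem_subformulas]))
    have hg := ihg (fun ψ hψ => h ψ (by simp [subformulas, hψ]))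
      (h g (by simp [subformulas, self_mem_subformulas]))
    first
    | simp only [LTLSat, hf, hg]; done
    | simp only [sat_untl_iff (consWord a _), sat_release_iff (consWord a _), tail, hf, hg, hφ]

/-- `P` holds of all words sharing a long enough prefix with `w`. -/
def HoldsNear (w : ℕ → Set AP) (P : (ℕ → Set AP) → Prop) : Prop :=
  ∀ᶠ n in atTop, ∀ w', (∀ k < n, w' k = w k) → P w'

theorem HoldsNear.and {w : ℕ → Set AP} {P Q : (ℕ → Set AP) → Prop}
    (hP : HoldsNear w P) (hQ : HoldsNear w Q) : HoldsNear w fun x => P x ∧ Q x := by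
  filter_upwards [hP, hQ] with n h₁ h₂ w' hw'
  exact ⟨h₁ w' hw', h₂ w' hw'⟩

theorem HoldsNear.mono {w : ℕ → Set AP} {P Q : (ℕ → Set AP) → Prop}
    (hP : HoldsNear w P) (h : ∀ x, P x → Q x) : HoldsNear w Q := by
  filter_upwards [hP] with n hn w' hw'
  exact h _ (hn w' hw')

theorem HoldsNear.forall_lt {w : ℕ → Set AP} {P : ℕ → (ℕ → Set AP) → Prop} {i : ℕ}
    (h : ∀ j < i, HoldsNear w (P j)) : HoldsNear w fun x => ∀ j < i, P j x := by
  filter_upwards [(eventually_all_finite (Set.finite_Iio i)).2 h] with n hn w' hw' j hj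
  exact hn j hj w' hw'

theorem HoldsNear.shift {w : ℕ → Set AP} {P : (ℕ → Set AP) → Prop} (i : ℕ)
    (h : HoldsNear (fun n => w (n + i)) P) : HoldsNear w fun x => P fun n => x (n + i) := by
  filter_upwards [(tendsto_sub_atTop_nat i).eventually h] with n hn w' hw'
  exact hn _ fun k hk => hw' (k + i) (by omega)

theorem holdsNear_of_letter {w : ℕ → Set AP} {P : Set AP → Prop} (h : P (w 0)) :
    HoldsNear w fun x => P (x 0) := by
  filter_upwards [eventually_gt_atTop 0] with n hn w' hw'
  rwa [hw' 0 hn]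

/-- A violation of a safety formula is witnessed by a finite prefix. -/
theorem holdsNear_not_sat {φ : LTL AP} (hφ : IsSafety φ) {w : ℕ → Set AP}
    (hw : ¬ LTLSat w φ) : HoldsNear w fun x => ¬ LTLSat x φ := by
  induction φ generalizing w with
  | tt => exact absurd trivial hw
  | ff => exact Eventually.of_forall fun _ _ _ => id
  | atom p => exact holdsNear_of_letter (P := fun a => p ∉ a) hw
  | not f _ =>
    cases f with
    | atom p => exact holdsNear_of_letter (P := fun a => ¬ p ∉ a) hw
    | _ => exact hφ.elim
  | and f g ihf ihg =>
    rcases not_and_or.1 hw with h | h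
    · exact (ihf hφ.1 h).mono fun x hx hs => hx hs.1
    · exact (ihg hφ.2 h).mono fun x hx hs => hx hs.2
  | or f g ihf ihg =>
    obtain ⟨h₁, h₂⟩ := not_or.1 hw
    exact ((ihf hφ.1 h₁).and (ihg hφ.2 h₂)).mono fun x hx => not_or.2 hx
  | next f ihf => exact (ihf hφ hw).shift 1
  | untl | ev => exact hφ.elim
  | release f g ihf ihg =>
    simp only [LTLSat, not_forall, not_or, not_exists, not_and] at hw
    obtain ⟨i, hg, hf⟩ := hw
    refine (((ihg hφ.2 hg).shift i).and
      (HoldsNear.forall_lt fun j hj => (ihf hφ.1 (hf j hj)).shift j)).mono fun x hx hs => ?_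
    rcases hs i with h | ⟨j, hj, h⟩
    · exact hx.1 h
    · exact hx.2 j hj h
  | glob f ihf =>
    obtain ⟨i, hi⟩ := not_forall.1 hw
    exact ((ihf hφ hi).shift i).mono fun x hx hs => hx (hs i)

/-- The subformula occurrences of `φ` satisfied by a word. -/
def valuation (φ : LTL AP) (x : ℕ → Set AP) : Set (Fin φ.subformulas.length) :=
  {i | LTLSat x (φ.subformulas.get i)}

theorem sat_iff_of_valuation_eq {φ : LTL AP} {x y : ℕ → Set AP}
    (h : φ.valuation x = φ.valuation y) {ψ : LTL AP} (hψ : ψ ∈ φ.subformulas) :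
    LTLSat x ψ ↔ LTLSat y ψ := by
  obtain ⟨i, rfl⟩ := List.get_of_mem hψ
  exact Set.ext_iff.1 h i

theorem mem_subformulas_trans {φ ψ χ : LTL AP} (hψ : ψ ∈ φ.subformulas)
    (hχ : χ ∈ ψ.subformulas) : χ ∈ φ.subformulas := by
  induction φ <;> grind [subformulas]

theorem valuation_consWord_congr {φ : LTL AP} (a : Set AP) {x y : ℕ → Set AP}
    (h : φ.valuation x = φ.valuation y) :
    φ.valuation (consWord a x) = φ.valuation (consWord a y) := by
  ext i
  exact sat_consWord_congr a _ fun ψ hψ =>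
    sat_iff_of_valuation_eq h (mem_subformulas_trans (List.get_mem _ i) hψ)

/-- The valuations of words satisfying `φ`. -/
def initState (φ : LTL AP) : Set (Set (Fin φ.subformulas.length)) :=
  φ.valuation '' {x | LTLSat x φ}

/-- The valuations of words that reach `S` when the letter `a` is prepended. -/
def succState (φ : LTL AP) (S : Set (Set (Fin φ.subformulas.length))) (a : Set AP) :
    Set (Set (Fin φ.subformulas.length)) :=
  φ.valuation '' {x | φ.valuation (consWord a x) ∈ S}

theorem valuation_mem_initState {φ : LTL AP} {x : ℕ → Set AP} :
    φ.valuation x ∈ φ.initState ↔ LTLSat x φ := by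
  refine ⟨?_, fun h => ⟨x, h, rfl⟩⟩
  rintro ⟨y, hy, h⟩
  exact (sat_iff_of_valuation_eq h φ.self_mem_subformulas).1 hy

theorem valuation_mem_succState {φ : LTL AP} {S : Set (Set (Fin φ.subformulas.length))}
    {a : Set AP} {x : ℕ → Set AP} :
    φ.valuation x ∈ φ.succState S a ↔ φ.valuation (consWord a x) ∈ S := by
  refine ⟨?_, fun h => ⟨x, h, rfl⟩⟩
  rintro ⟨y, hy, h⟩
  rwa [← valuation_consWord_congr a h]

/-- The state reached after reading the first `n` letters of `w`. -/
def stateAfter (φ : LTL AP) (w : ℕ → Set AP) : ℕ → Set (Set (Fin φ.subformulas.length))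
  | 0 => φ.initState
  | n + 1 => φ.succState (stateAfter φ w n) (w n)

/-- The word `x` preceded by the first `n` letters of `w`. -/
def splice (w : ℕ → Set AP) : ℕ → (ℕ → Set AP) → ℕ → Set AP
  | 0, x => x
  | n + 1, x => splice w n (consWord (w n) x)

theorem splice_apply_of_lt (w : ℕ → Set AP) {n k : ℕ} (hk : k < n) (x : ℕ → Set AP) :
    splice w n x k = w k := by
  have splice_add (n j : ℕ) (x : ℕ → Set AP) : splice w n x (n + j) = x j := by
    induction n generalizing x j with
    | zero => simp [splice]
    | succ n ih =>
      rw [Nat.add_assoc, Nat.add_comm 1]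
      exact ih (j + 1) _
  induction n generalizing x with
  | zero => omega
  | succ n ih =>
    rcases Nat.lt_succ_iff_lt_or_eq.1 hk with h | rfl
    · exact ih h _
    · exact splice_add k 0 _

theorem splice_drop (w : ℕ → Set AP) (n : ℕ) : splice w n (fun k => w (k + n)) = w := by
  induction n with
  | zero => rfl
  | succ n ih =>
    have : consWord (w n) (fun k => w (k + (n + 1))) = fun k => w (k + n) := by
      funext k
      cases k with
      | zero => simp [consWord]
      | succ k => simp [consWord, Nat.add_assoc, Nat.add_comm 1]
    rw [splice, this, ih]

theorem valuation_mem_stateAfter {φ : LTL AP} {w : ℕ → Set AP} {n : ℕ} {x : ℕ → Set AP} :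
    φ.valuation x ∈ φ.stateAfter w n ↔ LTLSat (splice w n x) φ := by
  induction n generalizing x with
  | zero => exact valuation_mem_initState
  | succ n ih => exact valuation_mem_succState.trans ih

open Classical in
/-- The deterministic automaton tracking which valuations of the remaining word lead to
satisfaction of `φ`. -/
noncomputable def safetyAut (φ : LTL AP) : SymbSafetyAut AP where
  Var := Set (Fin φ.subformulas.length)
  init S := S = φ.initState
  trans S S' a := (∃ x, φ.valuation x ∈ S) ∧ S' = φ.succState S a

theorem card_var_safetyAut (φ : LTL AP) : Fintype.card φ.safetyAut.Var = 2 ^ φ.size := by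
  classical
  rw [← length_subformulas, ← Nat.card_eq_fintype_card]
  change Nat.card (Set (Fin φ.subformulas.length)) = _
  simp

theorem deterministic_safetyAut (φ : LTL AP) : φ.safetyAut.Deterministic :=
  ⟨fun _ _ h h' => Eq.trans h (Eq.symm h'), fun _ _ _ _ h h' => h.2.trans h'.2.symm⟩

theorem lang_safetyAut {φ : LTL AP} (hφ : IsSafety φ) :
    φ.safetyAut.Lang = {w | LTLSat w φ} := by
  ext w
  constructor
  · rintro ⟨ρ, h0, hρ⟩
    have hstate (n : ℕ) : ρ n = φ.stateAfter w n := by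
      induction n with
      | zero => exact h0
      | succ n ih => rw [(hρ n).2, ih]; rfl
    by_contra hw
    obtain ⟨n, hn⟩ := (holdsNear_not_sat hφ hw).exists
    obtain ⟨x, hx⟩ := (hρ n).1
    rw [hstate] at hx
    exact hn _ (fun k hk => splice_apply_of_lt w hk x) (valuation_mem_stateAfter.1 hx)
  · intro hw
    refine ⟨φ.stateAfter w, rfl, fun n => ⟨⟨fun k => w (k + n), ?_⟩, rfl⟩⟩
    rw [valuation_mem_stateAfter, splice_drop]
    exact hw

end LTL

/-- Every safety LTL formula `φ` can be translated to a deterministic symbolic safety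
automaton over at most `2^|φ|` variables (hence with at most `2^(2^|φ|)` states when
expanded) accepting the same language. -/
theorem safety_to_deterministic_symbolic_automaton
    {AP : Type} [Fintype AP] (φ : LTL AP) (hφ : IsSafety φ) :
    ∃ D : SymbSafetyAut AP,
      Fintype.card D.Var ≤ 2 ^ φ.size ∧ D.Deterministic ∧
      D.Lang = {w : ℕ → Set AP | LTLSat w φ} :=
  ⟨φ.safetyAut, φ.card_var_safetyAut.le, φ.deterministic_safetyAut, LTL.lang_safetyAut hφ⟩
end

section
/- Let φ = φ_safety ∧ φ_EL be a safety and Emerson-Lei formula over AP = I ⊎ O, let D_symb be the deterministic symbolic safety automaton for φ_safety, and let G_φ = ⟨V ⊎ AP, I, O ⊎ V, θ₀, T, φ_EL⟩ be the induced symbolic game. Then the system (existential player) wins G_φ if and only if φ is realizable. -/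
/-- Boolean (state) formulas: LTL formulas without temporal operators. -/
def IsBool {AP : Type} : LTL AP → Prop
  | .tt => True
  | .ff => True
  | .atom _ => True
  | .not f => IsBool f
  | .and f g => IsBool f ∧ IsBool g
  | .or f g => IsBool f ∧ IsBool g
  | _ => False

/-- The Emerson-Lei fragment of LTL: positive Boolean combinations of formulas `GF ψ`
and `FG ψ'` for Boolean formulas `ψ`, `ψ'` over the atomic propositions
(`FG ¬ψ` is covered since `¬ψ` is Boolean whenever `ψ` is). -/
def IsEL {AP : Type} : LTL AP → Prop
  | .and f g => IsEL f ∧ IsEL g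
  | .or f g => IsEL f ∧ IsEL g
  | .glob (.ev ψ) => IsBool ψ
  | .ev (.glob ψ) => IsBool ψ
  | _ => False

/-- Combine an input valuation and an output valuation into a letter over `I ⊎ O`. -/
def combine {I O : Type} (x : Set I) (o : Set O) : Set (I ⊕ O) :=
  Sum.inl '' x ∪ Sum.inr '' o

/-- Realizability of an LTL formula over `AP = I ⊎ O`: there is a strategy
`σ : (2^I)^+ → 2^O` such that for every infinite input sequence the resulting
combined word satisfies `φ`. -/
def Realizable {I O : Type} (φ : LTL (I ⊕ O)) : Prop :=
  ∃ σ : List (Set I) → Set O, ∀ x : ℕ → Set I,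
    LTLSat (fun n => combine (x n) (σ ((List.range (n + 1)).map x))) φ

/-- The system (existential player) wins the symbolic game
`G_φ = ⟨V ⊎ AP, I, O ⊎ V, θ₀, T, ψ⟩` built from a symbolic safety automaton `D` and an
Emerson-Lei winning condition `ψ`: there is a strategy mapping each nonempty input
history to an output valuation and a valuation of the automaton variables such that,
along every input sequence, the initial variable valuation satisfies `θ₀`, every step
satisfies the transition assertion `T` (reading the combined input/output letter), and
the induced word over `2^AP` satisfies `ψ`. -/
def SystemWins {I O : Type} (D : SymbSafetyAut (I ⊕ O)) (ψ : LTL (I ⊕ O)) : Prop :=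
  ∃ τ : List (Set I) → Set O × Set D.Var,
    ∀ x : ℕ → Set I,
      D.init (τ ((List.range 1).map x)).2 ∧
      (∀ n : ℕ,
        D.trans (τ ((List.range (n + 1)).map x)).2 (τ ((List.range (n + 2)).map x)).2
          (combine (x n) (τ ((List.range (n + 1)).map x)).1)) ∧
      LTLSat (fun n => combine (x n) (τ ((List.range (n + 1)).map x)).1) ψ

/-- Runs of a deterministic automaton on words that agree on the first `n` letters agree in
position `n`. -/
theorem SymbSafetyAut.Deterministic.run_eq {AP : Type} {D : SymbSafetyAut AP}
    (hD : D.Deterministic) {w w' : ℕ → Set AP} {ρ ρ' : ℕ → Set D.Var}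
    (hρ : D.IsRun w ρ) (hρ' : D.IsRun w' ρ') (n : ℕ) (h : ∀ i < n, w i = w' i) :
    ρ n = ρ' n := by
  induction n with
  | zero => exact hD.1 _ _ hρ.1 hρ'.1
  | succ n ih =>
    have hn := ih fun i hi => h i (by omega)
    refine hD.2 (ρ n) _ _ (w n) (hρ.2 n) ?_
    rw [hn, h n (by omega)]
    exact hρ'.2 n

/-- The prefix of length `n` of a sequence, padded to an infinite sequence, has the same prefixes
up to length `n` as the original sequence. -/
theorem map_range_getD_map_range {α : Type} (x : ℕ → α) (d : α) {k n : ℕ} (hk : k ≤ n) :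
    (List.range k).map (fun i => ((List.range n).map x).getD i d) = (List.range k).map x := by
  refine List.map_congr_left fun i hi => ?_
  have hi' : i < n := (List.mem_range.mp hi).trans_le hk
  simp [List.getD, hi']

/-- Let `φ = φ_safety ∧ φ_EL` be a safety and Emerson-Lei formula over `AP = I ⊎ O`, let
`D` be a deterministic symbolic safety automaton for `φ_safety`, and let `G_φ` be the
induced symbolic game. Then the system (existential player) wins `G_φ` if and only if
`φ` is realizable. -/
theorem systemWins_iff_realizable
    {I O : Type} [Fintype I] [Fintype O]
    (φs φel : LTL (I ⊕ O)) (hs : IsSafety φs) (hel : IsEL φel)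
    (D : SymbSafetyAut (I ⊕ O)) (hD : D.Deterministic)
    (hL : D.Lang = {w : ℕ → Set (I ⊕ O) | LTLSat w φs}) :
    SystemWins D φel ↔ Realizable (φs.and φel) := by
  constructor
  · rintro ⟨τ, hτ⟩
    refine ⟨fun h => (τ h).1, fun x => ?_⟩
    obtain ⟨h0, hstep, hw⟩ := hτ x
    exact ⟨hL.subset ⟨fun n => (τ ((List.range (n + 1)).map x)).2, h0, hstep⟩, hw⟩
  · rintro ⟨σ, hσ⟩
    have hrun (x : ℕ → Set I) : ∃ ρ : ℕ → Set D.Var,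
        D.IsRun (fun n => combine (x n) (σ ((List.range (n + 1)).map x))) ρ :=
      hL.superset (hσ x).1
    choose ρ hρ using hrun
    let state (h : List (Set I)) : Set D.Var := ρ (fun i => h.getD i ∅) (h.length - 1)
    have hstate (x : ℕ → Set I) (n : ℕ) : state ((List.range (n + 1)).map x) = ρ x n := by
      simp only [state, List.length_map, List.length_range, Nat.add_sub_cancel]
      refine hD.run_eq (hρ _) (hρ x) n fun i hi => ?_
      have hi' : i < n + 1 := by omega
      simp only [map_range_getD_map_range x ∅ (show i + 1 ≤ n + 1 by omega)]
      simp [List.getD, hi']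
    refine ⟨fun h => (σ h, state h), fun x => ⟨?_, fun n => ?_, (hσ x).2⟩⟩
    · simpa only [hstate x 0] using (hρ x).1
    · simpa only [hstate x n, hstate x (n + 1)] using (hρ x).2 n
end
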